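/- Let K ⊂ ℝⁿ be an isotropic convex body with isotropy parameter M_K and isotropy constant L_K = M_K/|K|^{(n+2)/(2n)}, and let (C_m)_{m≥1} be Borel subsets of ℝⁿ with C_m ∩ int(K) = ∅, |C_m| > 0, |C_m| → 0, such that K_m := K ∪ C_m is a convex body for every m. Then there exist C > 0 and m₀ such that for all m ≥ m₀: | L_{K_m}^{2n} − L_K^{2n} [ 1 + (∫_{K_m\K} |X|² dX)/M_K² − (n+2)|K_m\K|/|K| ] | ≤ C L_K^{2n} |K_m\K|². -/

import Mathlib

open MeasureTheory Metric Set Filter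
open scoped InnerProductSpace Topology

noncomputable section

/-- A convex body in ℝⁿ: a compact convex set with nonempty interior. -/
def IsConvexBody {n : ℕ} (K : Set (EuclideanSpace ℝ (Fin n))) : Prop :=
  IsCompact K ∧ Convex ℝ K ∧ (interior K).Nonempty

/-- The centroid of a set. -/
def centroid {n : ℕ} (K : Set (EuclideanSpace ℝ (Fin n))) : EuclideanSpace ℝ (Fin n) :=
  ((volume K).toReal)⁻¹ • ∫ x in K, x

/-- `(1/n!) ∫_{A}⋯∫_{A} det(X₁ − g, …, Xₙ − g)² dX₁ ⋯ dXₙ`. -/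
def detInt {n : ℕ} (A : Set (EuclideanSpace ℝ (Fin n))) (g : EuclideanSpace ℝ (Fin n)) : ℝ :=
  ((n.factorial : ℝ))⁻¹ *
    ∫ X in Set.univ.pi (fun _ : Fin n => A),
      (Matrix.det (Matrix.of fun i j : Fin n => X j i - g i)) ^ 2
      ∂(Measure.pi fun _ : Fin n => volume)

/-- `M_K^{2n}`, the 2n-th power of the isotropy parameter of a convex body. -/
def Mpow2n {n : ℕ} (K : Set (EuclideanSpace ℝ (Fin n))) : ℝ := detInt K (centroid K)

/-- The isotropy constant `L_K = M_K / |K|^{(n+2)/(2n)}` of a convex body. -/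
def isoL (n : ℕ) (K : Set (EuclideanSpace ℝ (Fin n))) : ℝ :=
  (Mpow2n K) ^ ((2 * (n : ℝ)))⁻¹ / (volume K).toReal ^ (((n : ℝ) + 2) / (2 * n))

/-- `K` is isotropic with isotropy parameter `M`. -/
def IsIsotropic {n : ℕ} (K : Set (EuclideanSpace ℝ (Fin n))) (M : ℝ) : Prop :=
  0 < M ∧ (∫ x in K, x) = 0 ∧
    ∀ y : EuclideanSpace ℝ (Fin n), (∫ x in K, (⟪x, y⟫_ℝ) ^ 2) = M ^ 2 * ‖y‖ ^ 2

/-- `(N, q)` witnesses positive generalized Gauss curvature of `K` at `X₀`. -/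
def CurvWitness {n : ℕ} (K : Set (EuclideanSpace ℝ (Fin n))) (X₀ N : EuclideanSpace ℝ (Fin n))
    (q : QuadraticForm ℝ (EuclideanSpace ℝ (Fin n))) : Prop :=
  ‖N‖ = 1 ∧ (∀ x ∈ K, 0 ≤ ⟪x - X₀, N⟫_ℝ) ∧
  (∀ Y : EuclideanSpace ℝ (Fin n), ⟪Y, N⟫_ℝ = 0 → Y ≠ 0 → 0 < q Y) ∧
  ∀ ε > (0 : ℝ), ∃ a > (0 : ℝ), ∀ (Y : EuclideanSpace ℝ (Fin n)) (y : ℝ), ⟪Y, N⟫_ℝ = 0 →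
    X₀ + Y + y • N ∈ frontier K ∩ Metric.ball X₀ a →
    (1 - ε) * q Y ≤ y ∧ y ≤ (1 + ε) * q Y

/-- `K` has positive generalized Gauss curvature at `X₀`. -/
def HasPosGenCurvature {n : ℕ} (K : Set (EuclideanSpace ℝ (Fin n)))
    (X₀ : EuclideanSpace ℝ (Fin n)) : Prop :=
  ∃ N q, CurvWitness K X₀ N q

/-- `K` is a local maximizer for the isotropy constant (Hausdorff distance). -/
def IsLocalMaxIso {n : ℕ} (K : Set (EuclideanSpace ℝ (Fin n))) : Prop :=
  ∃ ε > (0 : ℝ), ∀ K' : Set (EuclideanSpace ℝ (Fin n)), IsConvexBody K' →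
    hausdorffDist K' K < ε → isoL n K' ≤ isoL n K

/-- `K` is a local minimizer for the isotropy constant (Hausdorff distance). -/
def IsLocalMinIso {n : ℕ} (K : Set (EuclideanSpace ℝ (Fin n))) : Prop :=
  ∃ ε > (0 : ℝ), ∀ K' : Set (EuclideanSpace ℝ (Fin n)), IsConvexBody K' →
    hausdorffDist K' K < ε → isoL n K ≤ isoL n K'

/-- `X₀` is a point of local strict convexity of `∂K`. -/
def IsLocalStrictConvexPoint {n : ℕ} (K : Set (EuclideanSpace ℝ (Fin n)))
    (X₀ : EuclideanSpace ℝ (Fin n)) : Prop :=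
  X₀ ∈ frontier K ∧
    ¬ ∃ A B : EuclideanSpace ℝ (Fin n), A ≠ B ∧ segment ℝ A B ⊆ frontier K ∧ X₀ ∈ segment ℝ A B


open Asymptotics

/-- **Andréief's identity** for squared determinants. -/
theorem integral_det_sq_pi {n : ℕ} {E : Type*} [MeasurableSpace E] (μ : Measure E) [SigmaFinite μ]
    (f : Fin n → E → ℝ) (hf : ∀ i j, Integrable (fun x => f i x * f j x) μ) :
    ∫ X, (Matrix.det (Matrix.of fun i j : Fin n => f i (X j))) ^ 2
        ∂(Measure.pi fun _ : Fin n => μ) =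
      (n.factorial : ℝ) * Matrix.det (Matrix.of fun i j : Fin n => ∫ x, f i x * f j x ∂μ) := by
  set S : Matrix (Fin n) (Fin n) ℝ := Matrix.of fun i j : Fin n => ∫ x, f i x * f j x ∂μ with hS
  have hexp : ∀ X : Fin n → E,
      (Matrix.det (Matrix.of fun i j : Fin n => f i (X j))) ^ 2 =
        ∑ τ : Equiv.Perm (Fin n), ∑ σ : Equiv.Perm (Fin n),
          (((Equiv.Perm.sign τ : ℤ) : ℝ) * ((Equiv.Perm.sign σ : ℤ) : ℝ)) *
            ∏ i, (f (σ i) (X i) * f (τ i) (X i)) := by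
    intro X
    rw [sq, Matrix.det_apply', Finset.sum_mul_sum]
    refine Finset.sum_congr rfl fun τ _ => Finset.sum_congr rfl fun σ _ => ?_
    rw [Finset.prod_mul_distrib]
    simp only [Matrix.of_apply]
    ring
  have hint : ∀ τ σ : Equiv.Perm (Fin n), Integrable (fun X : Fin n → E =>
      (((Equiv.Perm.sign τ : ℤ) : ℝ) * ((Equiv.Perm.sign σ : ℤ) : ℝ)) *
        ∏ i, (f (σ i) (X i) * f (τ i) (X i))) (Measure.pi fun _ : Fin n => μ) := by
    intro τ σ
    exact (Integrable.fintype_prod (f := fun i x => f (σ i) x * f (τ i) x)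
      fun i => hf (σ i) (τ i)).const_mul _
  simp_rw [hexp]
  rw [integral_finsetSum _ fun τ _ => integrable_finsetSum _ fun σ _ => hint τ σ]
  have hterm : ∀ τ : Equiv.Perm (Fin n),
      ∫ X, ∑ σ : Equiv.Perm (Fin n),
          (((Equiv.Perm.sign τ : ℤ) : ℝ) * ((Equiv.Perm.sign σ : ℤ) : ℝ)) *
            ∏ i, (f (σ i) (X i) * f (τ i) (X i)) ∂(Measure.pi fun _ : Fin n => μ) = S.det := by
    intro τ
    rw [integral_finsetSum _ fun σ _ => hint τ σ]
    have hdet : (S.submatrix id τ).det = ((Equiv.Perm.sign τ : ℤ) : ℝ) * S.det :=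
      Matrix.det_permute' τ S
    have hsq : ((Equiv.Perm.sign τ : ℤ) : ℝ) * ((Equiv.Perm.sign τ : ℤ) : ℝ) = 1 := by
      rcases Int.units_eq_one_or (Equiv.Perm.sign τ) with h | h <;> simp [h]
    calc _ = ((Equiv.Perm.sign τ : ℤ) : ℝ) * (S.submatrix id τ).det := by
          rw [Matrix.det_apply', Finset.mul_sum]
          refine Finset.sum_congr rfl fun σ _ => ?_
          rw [integral_const_mul,
            integral_fintype_prod_eq_prod (fun i x => f (σ i) x * f (τ i) x), mul_assoc]
          rfl
      _ = S.det := by rw [hdet, ← mul_assoc, hsq, one_mul]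
  simp_rw [hterm]
  simp [Fintype.card_perm]

theorem isBigO_mul_sub_one_sub_add {α : Type*} {l : Filter α} {f g a b u : α → ℝ}
    (hu : u =O[l] fun _ => (1 : ℝ)) (ha : a =O[l] u) (hb : b =O[l] u)
    (hf : (fun x => f x - 1 - a x) =O[l] fun x => u x ^ 2)
    (hg : (fun x => g x - 1 - b x) =O[l] fun x => u x ^ 2) :
    (fun x => f x * g x - 1 - (a x + b x)) =O[l] fun x => u x ^ 2 := by
  have h1 : (fun _ : α => (1 : ℝ)) =O[l] fun _ => (1 : ℝ) := isBigO_refl _ _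
  have hu2 : (fun x => u x ^ 2) =O[l] fun _ => (1 : ℝ) := by simpa using hu.pow 2
  have hgb : g =O[l] fun _ => (1 : ℝ) := by
    have := ((hg.trans hu2).add (hb.trans hu)).add h1
    refine this.congr_left fun x => by ring
  have h2 : (fun x => (f x - 1 - a x) * g x) =O[l] fun x => u x ^ 2 := by
    simpa using hf.mul hgb
  have h3 : (fun x => (1 + a x) * (g x - 1 - b x)) =O[l] fun x => u x ^ 2 := by
    simpa using (h1.add (ha.trans hu)).mul hg
  have h4 : (fun x => a x * b x) =O[l] fun x => u x ^ 2 := by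
    simpa [sq] using ha.mul hb
  refine ((h2.add h3).add h4).congr_left fun x => by ring

theorem isBigO_prod_one_add_sub {α ι : Type*} {l : Filter α} {u : α → ℝ} (s : Finset ι)
    {e : ι → α → ℝ} (hu : u =O[l] fun _ => (1 : ℝ)) (he : ∀ i, e i =O[l] u) :
    (fun x => ∏ i ∈ s, (1 + e i x) - 1 - ∑ i ∈ s, e i x) =O[l] fun x => u x ^ 2 := by
  classical
  induction s using Finset.induction_on with
  | empty => simpa using isBigO_zero _ _
  | insert i s hi ih =>
    simp only [Finset.prod_insert hi, Finset.sum_insert hi]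
    refine isBigO_mul_sub_one_sub_add hu (he i) (IsBigO.fun_sum fun j _ => he j) ?_ ih
    simpa using isBigO_zero _ _

theorem isBigO_det_one_add_sub {α ι : Type*} [Fintype ι] [DecidableEq ι] {l : Filter α} {u : α → ℝ}
    {E : α → Matrix ι ι ℝ} (hu : u =O[l] fun _ => (1 : ℝ))
    (hE : ∀ i j, (fun x => E x i j) =O[l] u) :
    (fun x => (1 + E x).det - 1 - (E x).trace) =O[l] fun x => u x ^ 2 := by
  have hsplit : ∀ x, (1 + E x).det - 1 - (E x).trace =
      (∏ i, (1 + E x i i) - 1 - ∑ i, E x i i) +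
        ∑ σ ∈ Finset.univ.erase (1 : Equiv.Perm ι), ((Equiv.Perm.sign σ : ℤ) : ℝ) *
          ∏ i, (1 + E x) (σ i) i := by
    intro x
    rw [Matrix.det_apply', ← Finset.add_sum_erase _ _ (Finset.mem_univ (1 : Equiv.Perm ι))]
    simp [Matrix.trace, Matrix.add_apply]
    ring
  simp_rw [hsplit]
  refine (isBigO_prod_one_add_sub _ hu fun i => hE i i).add (IsBigO.fun_sum fun σ hσ => ?_)
  refine IsBigO.const_mul_left ?_ _
  have hfac : ∀ i, (fun x => (1 + E x) (σ i) i) =O[l]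
      fun x => if σ i ≠ i then u x else 1 := by
    intro i
    by_cases h : σ i = i
    · simp only [h, Matrix.add_apply, Matrix.one_apply_eq, ne_eq, not_true_eq_false, if_false]
      exact (isBigO_refl _ _).add ((hE i i).trans hu)
    · simpa [h, Matrix.add_apply] using hE (σ i) i
  have hprod := IsBigO.finsetProd (s := Finset.univ) fun i _ => hfac i
  refine hprod.trans ?_
  have hcard : 2 ≤ σ.support.card :=
    Equiv.Perm.two_le_card_support_of_ne_one (Finset.ne_of_mem_erase hσ)
  obtain ⟨k, hk⟩ := Nat.exists_eq_add_of_le hcard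
  have hpow : ∀ x, (∏ i, if σ i ≠ i then u x else 1) = u x ^ 2 * u x ^ k := by
    intro x
    rw [← pow_add, ← hk, Finset.prod_ite]
    simp [Equiv.Perm.support]
  simp_rw [hpow]
  simpa using (isBigO_refl (fun x => u x ^ 2) l).mul (hu.pow k)

theorem abs_inv_one_add_pow_sub_le (k : ℕ) {s : ℝ} (hs : 0 ≤ s) :
    |((1 + s) ^ k)⁻¹ - 1 - (-(k * s))| ≤ (k : ℝ) ^ 2 * s ^ 2 := by
  have hk : (0 : ℝ) ≤ k := Nat.cast_nonneg k
  have hks : 0 ≤ k * s := mul_nonneg hk hs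
  have hB : 1 + k * s ≤ (1 + s) ^ k := one_add_mul_le_pow (by linarith) k
  have hup : ((1 + s) ^ k)⁻¹ ≤ 1 - k * s + (k * s) ^ 2 := by
    refine (inv_anti₀ (by positivity) hB).trans ?_
    rw [inv_le_iff_one_le_mul₀ (by positivity)]
    nlinarith [pow_nonneg hks 3]
  have hfrac : s / (1 + s) ≤ s := div_le_self hs (by linarith)
  have hlow : 1 - k * s ≤ ((1 + s) ^ k)⁻¹ := by
    have h1 : (1 + s)⁻¹ = 1 + -(s / (1 + s)) := by field_simp; ring
    have h0 : s / (1 + s) ≤ 1 := by rw [div_le_one (by positivity)]; linarith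
    rw [← inv_pow, h1]
    refine le_trans ?_ (one_add_mul_le_pow (by linarith) k)
    nlinarith
  rw [abs_le]
  constructor <;> nlinarith [sq_nonneg (k * s)]

theorem dist_le_of_convex_union_of_volume_lt {n : ℕ} {K C : Set (EuclideanSpace ℝ (Fin n))}
    {a : EuclideanSpace ℝ (Fin n)} {r R : ℝ} (hr : ball a r ⊆ K) (hR : K ⊆ closedBall a R)
    (hconv : Convex ℝ (K ∪ C))
    (hvol : volume C < volume (ball (0 : EuclideanSpace ℝ (Fin n)) (r / 2)))
    {x : EuclideanSpace ℝ (Fin n)} (hx : x ∈ K ∪ C) : dist x a ≤ 2 * R + r := by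
  by_contra! hlt
  have hsub : ball (midpoint ℝ x a) (r / 2) ⊆ C := by
    intro y hy
    have hmid : ‖y - midpoint ℝ x a‖ < r / 2 := by rwa [mem_ball, dist_eq_norm] at hy
    have hyeq : y - midpoint ℝ x a = (2 : ℝ)⁻¹ • ((2 : ℝ) • y - x - a) := by
      rw [midpoint_eq_smul_add, invOf_eq_inv]; module
    have hz : (2 : ℝ) • y - x ∈ ball a r := by
      rw [mem_ball, dist_eq_norm]
      rw [hyeq, norm_smul] at hmid
      norm_num at hmid
      linarith
    have hyL : y ∈ K ∪ C := by
      have := hconv hx (Or.inl (hr hz)) (by norm_num : (0 : ℝ) ≤ 1 / 2)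
        (by norm_num : (0 : ℝ) ≤ 1 / 2) (by norm_num)
      convert this using 1
      module
    refine hyL.resolve_left fun hyK => ?_
    have h1 : dist y a ≤ R := hR hyK
    have h2 : dist (midpoint ℝ x a) a = 2⁻¹ * dist x a := by
      rw [dist_midpoint_right]; norm_num
    have h3 := dist_triangle_left (midpoint ℝ x a) a y
    rw [mem_ball] at hy
    linarith
  have := measure_mono (μ := volume) hsub
  rw [Measure.addHaar_ball_center] at this
  exact absurd hvol this.not_gt

theorem integral_coord {n : ℕ} {A : Set (EuclideanSpace ℝ (Fin n))} (hA : IsCompact A)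
    (i : Fin n) : (∫ x in A, x) i = ∫ x in A, x i := by
  have h : IntegrableOn (fun x : EuclideanSpace ℝ (Fin n) => x) A :=
    continuous_id.continuousOn.integrableOn_compact hA
  exact ((EuclideanSpace.proj (𝕜 := ℝ) i).integral_comp_comm h).symm

theorem Mpow2n_eq_det {n : ℕ} {A : Set (EuclideanSpace ℝ (Fin n))} (hA : IsCompact A)
    (hpos : 0 < (volume A).toReal) :
    Mpow2n A = Matrix.det (Matrix.of fun i j : Fin n =>
      (∫ x in A, x i * x j) -
        ((volume A).toReal)⁻¹ * ((∫ x in A, x i) * ∫ x in A, x j)) := by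
  have hint : ∀ f : EuclideanSpace ℝ (Fin n) → ℝ, Continuous f → IntegrableOn f A :=
    fun f hf => hf.continuousOn.integrableOn_compact hA
  have : IsFiniteMeasure (volume.restrict A) := ⟨by simpa using hA.measure_lt_top⟩
  rw [Mpow2n, detInt, Measure.restrict_pi_pi,
    integral_det_sq_pi _ (fun i (x : EuclideanSpace ℝ (Fin n)) => x i - centroid A i)
      (fun i j => hint _ (by fun_prop)),
    inv_mul_cancel_left₀ (by positivity)]
  congr 1
  ext i j
  simp only [Matrix.of_apply]
  have hg : ∀ k, centroid A k = ((volume A).toReal)⁻¹ * ∫ x in A, x k := by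
    intro k
    rw [centroid, PiLp.smul_apply, integral_coord hA, smul_eq_mul]
  have hexp : ∀ x : EuclideanSpace ℝ (Fin n),
      (x i - centroid A i) * (x j - centroid A j) =
        x i * x j - centroid A j * x i - centroid A i * x j + centroid A i * centroid A j := by
    intro x; ring
  simp_rw [hexp]
  rw [integral_add (hint _ (by fun_prop)) (hint _ (by fun_prop)),
    integral_sub (hint _ (by fun_prop)) (hint _ (by fun_prop)),
    integral_sub (hint _ (by fun_prop)) (hint _ (by fun_prop)), integral_const_mul,
    integral_const_mul, setIntegral_const, smul_eq_mul, hg, hg, Measure.real]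
  field_simp
  ring

theorem Mpow2n_nonneg {n : ℕ} (A : Set (EuclideanSpace ℝ (Fin n))) : 0 ≤ Mpow2n A :=
  mul_nonneg (by positivity) (integral_nonneg fun _ => sq_nonneg _)

theorem rpow_div_pow_two_mul {n : ℕ} (hn : 0 < n) {V : ℝ} (hV : 0 ≤ V) :
    (V ^ (((n : ℝ) + 2) / (2 * n))) ^ (2 * n) = V ^ (n + 2) := by
  rw [← Real.rpow_natCast, ← Real.rpow_mul hV, ← Real.rpow_natCast V]
  congr 1
  have : (n : ℝ) ≠ 0 := by positivity
  push_cast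
  field_simp

theorem isoL_pow_two_mul {n : ℕ} (hn : 0 < n) (A : Set (EuclideanSpace ℝ (Fin n))) :
    isoL n A ^ (2 * n) = Mpow2n A / (volume A).toReal ^ (n + 2) := by
  rw [isoL, div_pow, rpow_div_pow_two_mul hn ENNReal.toReal_nonneg]
  congr 1
  have h := Real.rpow_inv_natCast_pow (Mpow2n_nonneg A) (n := 2 * n) (by positivity)
  push_cast at h
  exact h

theorem IsIsotropic.integral_mul_coord {n : ℕ} {K : Set (EuclideanSpace ℝ (Fin n))} {M : ℝ}
    (hiso : IsIsotropic K M) (hK : IsCompact K) (i j : Fin n) :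
    ∫ x in K, x i * x j = M ^ 2 * (1 : Matrix (Fin n) (Fin n) ℝ) i j := by
  have hint : ∀ f : EuclideanSpace ℝ (Fin n) → ℝ, Continuous f → IntegrableOn f K :=
    fun f hf => hf.continuousOn.integrableOn_compact hK
  have hsq : ∀ k : Fin n, ∫ x in K, x k ^ 2 = M ^ 2 := by
    intro k
    have := hiso.2.2 (EuclideanSpace.single k 1)
    simpa [EuclideanSpace.inner_single_right] using this
  rcases eq_or_ne i j with rfl | hij
  · simpa [sq] using hsq i
  · have h := hiso.2.2 (EuclideanSpace.single i 1 + EuclideanSpace.single j 1)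
    have hnorm : ‖(EuclideanSpace.single i 1 + EuclideanSpace.single j 1 :
        EuclideanSpace ℝ (Fin n))‖ ^ 2 = 2 := by
      rw [@norm_add_sq_real]
      simp [EuclideanSpace.inner_single_right, hij]
      norm_num
    have hexp : ∀ x : EuclideanSpace ℝ (Fin n),
        ⟪x, EuclideanSpace.single i 1 + EuclideanSpace.single j 1⟫_ℝ ^ 2 =
          x i ^ 2 + x j ^ 2 + 2 * (x i * x j) := by
      intro x
      rw [inner_add_right]
      simp [EuclideanSpace.inner_single_right]
      ring
    simp_rw [hexp] at h
    rw [hnorm, integral_add (hint _ (by fun_prop)) (hint _ (by fun_prop)),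
      integral_add (hint _ (by fun_prop)) (hint _ (by fun_prop)), integral_const_mul, hsq,
      hsq] at h
    rw [Matrix.one_apply_ne hij]
    linarith

/-- **Proposition 4, outer case (Meyer–Reisner).** Asymptotic expansion of
`L_{K_m}^{2n}` for `K_m = K ∪ C_m`. -/
theorem isoL_pow_union_outer_sets {n : ℕ} (K : Set (EuclideanSpace ℝ (Fin n))) (M : ℝ)
    (hK : IsConvexBody K) (hiso : IsIsotropic K M)
    (C : ℕ → Set (EuclideanSpace ℝ (Fin n)))
    (hmeas : ∀ m, MeasurableSet (C m))
    (hdisj : ∀ m, C m ∩ interior K = ∅)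
    (hpos : ∀ m, 0 < volume (C m))
    (hto0 : Tendsto (fun m => volume (C m)) atTop (𝓝 0))
    (hconv : ∀ m, IsConvexBody (K ∪ C m)) :
    ∃ c > (0 : ℝ), ∃ m₀ : ℕ, ∀ m ≥ m₀,
      |(isoL n (K ∪ C m)) ^ (2 * n)
          - (M / (volume K).toReal ^ (((n : ℝ) + 2) / (2 * n))) ^ (2 * n) *
            (1 + (∫ x in (K ∪ C m) \ K, ‖x‖ ^ 2) / M ^ 2
              - ((n : ℝ) + 2) * (volume ((K ∪ C m) \ K)).toReal / (volume K).toReal)|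
        ≤ c * (M / (volume K).toReal ^ (((n : ℝ) + 2) / (2 * n))) ^ (2 * n) *
            ((volume ((K ∪ C m) \ K)).toReal) ^ 2 := by
  have hn : 0 < n := by
    rcases Nat.eq_zero_or_pos n with rfl | h
    · exfalso
      obtain ⟨x, hx⟩ := nonempty_of_measure_ne_zero (hpos 0).ne'
      obtain ⟨y, hy⟩ := hK.2.2
      have : x ∈ C 0 ∩ interior K := ⟨hx, Subsingleton.elim y x ▸ hy⟩
      rw [hdisj] at this
      exact this
    · exact h
  have hM : 0 < M := hiso.1
  set V : ℝ := (volume K).toReal with hVdef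
  have hV : 0 < V := ENNReal.toReal_pos
    ((isOpen_interior.measure_pos volume hK.2.2).trans_le (measure_mono interior_subset)).ne'
    hK.1.measure_ne_top
  set D : ℕ → Set (EuclideanSpace ℝ (Fin n)) := fun m => (K ∪ C m) \ K with hD
  set v : ℕ → ℝ := fun m => (volume (D m)).toReal with hv
  have hDmeas : ∀ m, MeasurableSet (D m) := fun m =>
    (hconv m).1.measurableSet.diff hK.1.measurableSet
  have hDC : ∀ m, D m ⊆ C m := fun m x hx => hx.1.resolve_left hx.2
  have hDtop : ∀ m, volume (D m) < ⊤ := fun m =>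
    (measure_mono sdiff_subset).trans_lt (hconv m).1.measure_lt_top
  have hv0 : ∀ m, 0 ≤ v m := fun m => ENNReal.toReal_nonneg
  have hKD : ∀ m, K ∪ C m = K ∪ D m := fun m => by
    simp [hD]
  have hdisjD : ∀ m, Disjoint K (D m) := fun m => disjoint_sdiff_right
  have hVm : ∀ m, (volume (K ∪ C m)).toReal = V + v m := by
    intro m
    rw [hKD, measure_union (hdisjD m) (hDmeas m),
      ENNReal.toReal_add hK.1.measure_ne_top (hDtop m).ne]
  have hsplit : ∀ m (f : EuclideanSpace ℝ (Fin n) → ℝ), Continuous f →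
      ∫ x in K ∪ C m, f x = (∫ x in K, f x) + ∫ x in D m, f x := by
    intro m f hf
    have hi : IntegrableOn f (K ∪ C m) := hf.continuousOn.integrableOn_compact (hconv m).1
    rw [hKD, setIntegral_union (hdisjD m) (hDmeas m) (hi.mono_set subset_union_left)
      (hi.mono_set sdiff_subset)]
  -- the sets are eventually contained in a fixed ball, and their measures tend to `0`
  obtain ⟨a, ha⟩ := hK.2.2
  obtain ⟨r, hr, hball⟩ := Metric.isOpen_iff.1 isOpen_interior a ha
  obtain ⟨R, hR⟩ := hK.1.isBounded.subset_closedBall a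
  obtain ⟨B, hB⟩ : ∃ B : ℝ, ∀ᶠ m in atTop, ∀ x ∈ D m, ‖x‖ ≤ B := by
    refine ⟨2 * R + r + ‖a‖, ?_⟩
    have hbpos : 0 < volume (ball (0 : EuclideanSpace ℝ (Fin n)) (r / 2)) :=
      measure_ball_pos _ _ (by positivity)
    filter_upwards [hto0.eventually (gt_mem_nhds hbpos)] with m hm x hx
    have h1 := dist_le_of_convex_union_of_volume_lt (hball.trans interior_subset) hR
      (hconv m).2.1 hm hx.1
    have h2 := norm_le_norm_add_norm_sub' x a
    rw [← dist_eq_norm] at h2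
    linarith
  have hvO : v =O[atTop] fun _ => (1 : ℝ) := by
    refine IsBigO.of_bound 1 ?_
    filter_upwards [hto0.eventually (gt_mem_nhds one_pos)] with m hm
    rw [Real.norm_of_nonneg (hv0 m), norm_one, one_mul]
    exact ENNReal.toReal_le_of_le_ofReal zero_le_one
      (by simpa using (measure_mono (hDC m)).trans hm.le)
  have hintO : ∀ (f : EuclideanSpace ℝ (Fin n) → ℝ) (c : ℝ),
      (∀ x, ‖x‖ ≤ B → ‖f x‖ ≤ c) → (fun m => ∫ x in D m, f x) =O[atTop] v := by
    intro f c hf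
    refine IsBigO.of_bound c ?_
    filter_upwards [hB] with m hm
    rw [Real.norm_of_nonneg (hv0 m)]
    exact norm_setIntegral_le_of_norm_le_const (hDtop m) fun x hx => hf x (hm x hx)
  have hcoordO : ∀ i, (fun m => ∫ x in D m, x i) =O[atTop] v := fun i =>
    hintO _ B fun x hx => (PiLp.norm_apply_le x i).trans hx
  have hmulO : ∀ i j, (fun m => ∫ x in D m, x i * x j) =O[atTop] v := fun i j =>
    hintO _ (B * B) fun x hx => by
      rw [norm_mul]
      have hB0 : 0 ≤ B := (norm_nonneg x).trans hx
      exact mul_le_mul ((PiLp.norm_apply_le x i).trans hx) ((PiLp.norm_apply_le x j).trans hx)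
        (norm_nonneg _) hB0
  have hinvO : (fun m => (V + v m)⁻¹) =O[atTop] fun _ => (1 : ℝ) := by
    refine IsBigO.of_bound V⁻¹ (Eventually.of_forall fun m => ?_)
    have := hv0 m
    rw [Real.norm_of_nonneg (by positivity), norm_one, mul_one]
    exact inv_anti₀ hV (by linarith)
  have hcorrO : ∀ i j, (fun m => (V + v m)⁻¹ * ((∫ x in D m, x i) * ∫ x in D m, x j))
      =O[atTop] fun m => v m ^ 2 := fun i j => by
    simpa [sq] using hinvO.mul ((hcoordO i).mul (hcoordO j))
  have hsqO : (fun m => v m ^ 2) =O[atTop] v := by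
    simpa [sq] using hvO.mul (isBigO_refl v atTop)
  -- the normalized perturbation of the inertia matrix
  set E : ℕ → Matrix (Fin n) (Fin n) ℝ := fun m => Matrix.of fun i j =>
    (M ^ 2)⁻¹ * ((∫ x in D m, x i * x j) -
      (V + v m)⁻¹ * ((∫ x in D m, x i) * ∫ x in D m, x j)) with hE
  have hMpow : ∀ m, Mpow2n (K ∪ C m) = M ^ (2 * n) * (1 + E m).det := by
    intro m
    have hK1 : ∀ i, ∫ x in K, x i = 0 := fun i => by
      rw [← integral_coord hK.1, hiso.2.1]; rfl
    have hmat : (Matrix.of fun i j : Fin n =>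
        (∫ x in K ∪ C m, x i * x j) -
          ((volume (K ∪ C m)).toReal)⁻¹ * ((∫ x in K ∪ C m, x i) * ∫ x in K ∪ C m, x j)) =
        M ^ 2 • (1 + E m) := by
      ext i j
      simp only [Matrix.of_apply, Matrix.smul_apply, Matrix.add_apply, smul_eq_mul, hE]
      rw [hVm, hsplit m _ (by fun_prop), hsplit m _ (by fun_prop), hsplit m _ (by fun_prop), hK1,
        hK1, hiso.integral_mul_coord hK.1]
      field_simp
      ring
    rw [Mpow2n_eq_det (hconv m).1 (by rw [hVm]; linarith [hv0 m]), hmat, Matrix.det_smul,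
      Fintype.card_fin, pow_mul]
  have hEO : ∀ i j, (fun m => E m i j) =O[atTop] v := fun i j =>
    ((hmulO i j).sub ((hcorrO i j).trans hsqO)).const_mul_left _
  have hnormsq : ∀ m, ∫ x in D m, ‖x‖ ^ 2 = ∑ i, ∫ x in D m, x i * x i := by
    intro m
    rw [← integral_finsetSum]
    · refine integral_congr_ae (Eventually.of_forall fun x => ?_)
      simp only [EuclideanSpace.real_norm_sq_eq, sq (x _)]
    · intro i _
      have hc : Continuous fun x : EuclideanSpace ℝ (Fin n) => x i * x i := by fun_prop
      have hi := hc.continuousOn.integrableOn_compact (μ := volume) (hconv m).1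
      exact hi.mono_set sdiff_subset
  have hTO : (fun m => (∫ x in D m, ‖x‖ ^ 2) / M ^ 2) =O[atTop] v := by
    simp_rw [hnormsq, div_eq_inv_mul]
    exact (IsBigO.fun_sum fun i _ => hmulO i i).const_mul_left _
  have hdetO : (fun m => (1 + E m).det - 1 - (∫ x in D m, ‖x‖ ^ 2) / M ^ 2) =O[atTop]
      fun m => v m ^ 2 := by
    have htr : ∀ m, (E m).trace - (∫ x in D m, ‖x‖ ^ 2) / M ^ 2 =
        -((M ^ 2)⁻¹ * ∑ i, (V + v m)⁻¹ * ((∫ x in D m, x i) * ∫ x in D m, x i)) := by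
      intro m
      simp only [hE, Matrix.trace, Matrix.diag_apply, Matrix.of_apply, hnormsq,
        ← Finset.mul_sum, Finset.sum_sub_distrib]
      ring
    have htrO : (fun m => (E m).trace - (∫ x in D m, ‖x‖ ^ 2) / M ^ 2) =O[atTop]
        fun m => v m ^ 2 := by
      simp_rw [htr]
      exact ((IsBigO.fun_sum fun i _ => hcorrO i i).const_mul_left _).neg_left
    refine ((isBigO_det_one_add_sub hvO hEO).add htrO).congr_left fun m => by ring
  have hpowO : (fun m => ((1 + v m / V) ^ (n + 2))⁻¹ - 1 - (-(((n + 2 : ℕ) : ℝ) * (v m / V))))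
      =O[atTop] fun m => v m ^ 2 := by
    refine IsBigO.of_bound (((n + 2 : ℕ) : ℝ) ^ 2 / V ^ 2) (Eventually.of_forall fun m => ?_)
    have := abs_inv_one_add_pow_sub_le (n + 2) (div_nonneg (hv0 m) hV.le)
    rw [Real.norm_eq_abs, Real.norm_of_nonneg (sq_nonneg _)]
    refine this.trans_eq ?_
    rw [div_pow]
    ring
  have hbO : (fun m => -(((n + 2 : ℕ) : ℝ) * (v m / V))) =O[atTop] v := by
    simp_rw [div_eq_inv_mul]
    exact (((isBigO_refl v atTop).const_mul_left _).const_mul_left _).neg_left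
  obtain ⟨c, hc, hbound⟩ := (isBigO_mul_sub_one_sub_add hvO hTO hbO hdetO hpowO).exists_pos
  obtain ⟨m₀, hm₀⟩ := eventually_atTop.1 hbound.bound
  refine ⟨c, hc, m₀, fun m hm => ?_⟩
  have hmain := hm₀ m hm
  rw [Real.norm_eq_abs, Real.norm_of_nonneg (sq_nonneg _)] at hmain
  have hΛ : (M / V ^ (((n : ℝ) + 2) / (2 * n))) ^ (2 * n) = M ^ (2 * n) / V ^ (n + 2) := by
    rw [div_pow, rpow_div_pow_two_mul hn hV.le]
  have hΛ0 : 0 ≤ M ^ (2 * n) / V ^ (n + 2) := by positivity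
  have hL : isoL n (K ∪ C m) ^ (2 * n) = M ^ (2 * n) / V ^ (n + 2) *
      ((1 + E m).det * ((1 + v m / V) ^ (n + 2))⁻¹) := by
    have h1 : V + v m = V * (1 + v m / V) := by field_simp
    rw [isoL_pow_two_mul hn, hVm, hMpow, h1, mul_pow]
    field_simp
  rw [hΛ, hL]
  calc _ = |M ^ (2 * n) / V ^ (n + 2) * ((1 + E m).det * ((1 + v m / V) ^ (n + 2))⁻¹ - 1 -
        ((∫ x in D m, ‖x‖ ^ 2) / M ^ 2 + -(((n + 2 : ℕ) : ℝ) * (v m / V))))| := by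
        congr 1
        push_cast
        ring
    _ ≤ M ^ (2 * n) / V ^ (n + 2) * (c * v m ^ 2) := by
        rw [abs_mul, abs_of_nonneg hΛ0]
        exact mul_le_mul_of_nonneg_left hmain hΛ0
    _ = _ := by ring
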